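/- Let C̲ be a G-coalgebra with C_e cocommutative, and let Ω_{C̲} be the set of morphisms of G-coalgebras u̲ : C̲ → k⟨G⟩. Suppose Ω_{C̲} ≠ ∅ and fix u⁰ ∈ Ω_{C̲}; let C_e carry the right G-module coalgebra structure c·α = λ_α(c) = u⁰_α(c_{(1,α)}) c_{(2,e)} u⁰_{α⁻¹}(c_{(3,α⁻¹)}), making 𝔾_m(C_e*) a left G-module via (α·f)(c) = f(c·α). Then: (1) the map φ sending u̲ ∈ Ω_{C̲} to θ : G → 𝔾_m(C_e*), θ_α(c) = u_α(c_{(1,α)}) u⁰_{α⁻¹}(c_{(2,α⁻¹)}), is a bijection from Ω_{C̲} onto the set Z¹(G, 𝔾_m(C_e*)) of 1-cocycles (families θ with (α·θ_β) * θ_α = θ_{αβ}), with inverse θ ↦ u̲ where u_α(c) = θ_α(c_{(1,e)}) u⁰_α(c_{(2,α)}); (2) defining u̲ ∼ u̲' iff there is a convolution invertible f ∈ C_e* with f(c_{(1,e)}) u_α(c_{(2,α)}) = u'_α(c_{(1,α)}) f(c_{(2,e)}) for all α ∈ G and c ∈ C_α, φ induces a bijection from Ω_{C̲}/∼ onto H¹(G,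 𝔾_m(C_e*)) = Z¹/B¹, where B¹ consists of the families θ_α = (α·f) * f⁻¹ with f ∈ 𝔾_m(C_e*). -/

import Mathlib

open TensorProduct

universe u

/-- A `G`-group coalgebra over `k`: a family of `k`-vector spaces `C α` with
comultiplications `Δ_{α,β} : C (α*β) → C α ⊗ C β` and a counit `ε : C 1 → k`.
The comultiplication takes an explicit proof `γ = α * β` to avoid dependent casts. -/
structure GCoalgebra (k : Type u) [Field k] (G : Type u) [Group G] where
  C : G → Type u
  [acg : ∀ α, AddCommGroup (C α)]
  [mod : ∀ α, Module k (C α)]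
  Δ : ∀ ⦃γ⦄ (α β : G), γ = α * β → (C γ →ₗ[k] C α ⊗[k] C β)
  ε : C 1 →ₗ[k] k
  coassoc : ∀ ⦃δ δ₁ δ₂ : G⦄ (α β γ : G) (h₁ : δ = δ₁ * γ) (h₁' : δ₁ = α * β)
      (h₂ : δ = α * δ₂) (h₂' : δ₂ = β * γ),
      (TensorProduct.assoc k (C α) (C β) (C γ)).toLinearMap ∘ₗ
        (TensorProduct.map (Δ α β h₁') LinearMap.id) ∘ₗ Δ δ₁ γ h₁
      = (TensorProduct.map LinearMap.id (Δ β γ h₂')) ∘ₗ Δ α δ₂ h₂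
  counit_right : ∀ (α : G) (h : α = α * 1),
      (TensorProduct.rid k (C α)).toLinearMap ∘ₗ
        (TensorProduct.map LinearMap.id ε) ∘ₗ Δ α 1 h = LinearMap.id
  counit_left : ∀ (α : G) (h : α = 1 * α),
      (TensorProduct.lid k (C α)).toLinearMap ∘ₗ
        (TensorProduct.map ε LinearMap.id) ∘ₗ Δ 1 α h = LinearMap.id

attribute [instance] GCoalgebra.acg GCoalgebra.mod

variable {k : Type u} [Field k] {G : Type u} [Group G]

/-- A right `G`-`C̲`-comodule. -/
structure GComodule (Cc : GCoalgebra k G) where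
  M : G → Type u
  [acg : ∀ α, AddCommGroup (M α)]
  [mod : ∀ α, Module k (M α)]
  ρ : ∀ ⦃γ⦄ (α β : G), γ = α * β → (M γ →ₗ[k] M α ⊗[k] Cc.C β)
  counit : ∀ (α : G) (h : α = α * 1),
      (TensorProduct.rid k (M α)).toLinearMap ∘ₗ
        (TensorProduct.map LinearMap.id Cc.ε) ∘ₗ ρ α 1 h = LinearMap.id
  coassoc : ∀ ⦃δ δ₁ δ₂ : G⦄ (α β γ : G) (h₁ : δ = δ₁ * γ) (h₁' : δ₁ = α * β)
      (h₂ : δ = α * δ₂) (h₂' : δ₂ = β * γ),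
      (TensorProduct.assoc k (M α) (Cc.C β) (Cc.C γ)).toLinearMap ∘ₗ
        (TensorProduct.map (ρ α β h₁') LinearMap.id) ∘ₗ ρ δ₁ γ h₁
      = (TensorProduct.map LinearMap.id (Cc.Δ β γ h₂')) ∘ₗ ρ α δ₂ h₂

attribute [instance] GComodule.acg GComodule.mod

/-- A morphism of right `G`-`C̲`-comodules. -/
structure GComodHom {Cc : GCoalgebra k G} (M N : GComodule Cc) where
  φ : ∀ α, M.M α →ₗ[k] N.M α
  colinear : ∀ ⦃γ⦄ (α β : G) (h : γ = α * β),
      (TensorProduct.map (φ α) LinearMap.id) ∘ₗ M.ρ α β h = N.ρ α β h ∘ₗ φ γ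

/-- A `G`-coalgebra is strong if all comultiplication maps are injective. -/
def GCoalgebra.Strong (Cc : GCoalgebra k G) : Prop :=
  ∀ (α β : G), Function.Injective (Cc.Δ α β rfl)
/-- The map `λ_α : C_e → C_e`, `λ_α(c) = u_α(c_{(1,α)}) c_{(2,e)} v_α(c_{(3,α⁻¹)})`,
attached to a convolution invertible `u̲ : C̲ → k⟨G⟩`. -/
noncomputable def cleftLam {k G : Type u} [Field k] [Group G] (Cc : GCoalgebra k G)
    (u : ∀ α : G, Cc.C α →ₗ[k] k) (v : ∀ α : G, Cc.C α⁻¹ →ₗ[k] k) (α : G) :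
    Cc.C 1 →ₗ[k] Cc.C 1 :=
  (TensorProduct.lid k (Cc.C 1)).toLinearMap ∘ₗ
    TensorProduct.map (u α)
      ((TensorProduct.rid k (Cc.C 1)).toLinearMap ∘ₗ
        TensorProduct.map LinearMap.id (v α)) ∘ₗ
    LinearMap.lTensor (Cc.C α) (Cc.Δ 1 α⁻¹ (one_mul α⁻¹).symm) ∘ₗ
    Cc.Δ α α⁻¹ (mul_inv_cancel α).symm

/-- `(u, v)` is a convolution invertible morphism `u̲ : C̲ → k⟨G⟩` in `(M_k)^G`:
`u_α(c_{(1,α)}) v_α(c_{(2,α⁻¹)}) = v_α(c_{(1,α⁻¹)}) u_α(c_{(2,α)}) = ε(c)`. -/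
def IsConvInvPair {k G : Type u} [Field k] [Group G] (Cc : GCoalgebra k G)
    (u : ∀ α : G, Cc.C α →ₗ[k] k) (v : ∀ α : G, Cc.C α⁻¹ →ₗ[k] k) : Prop :=
  ∀ α : G,
    LinearMap.mul' k k ∘ₗ TensorProduct.map (u α) (v α) ∘ₗ
        Cc.Δ α α⁻¹ (mul_inv_cancel α).symm = Cc.ε ∧
    LinearMap.mul' k k ∘ₗ TensorProduct.map (v α) (u α) ∘ₗ
        Cc.Δ α⁻¹ α (inv_mul_cancel α).symm = Cc.ε

/-- `C_e` is cocommutative. -/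
def CeCocommutative {k G : Type u} [Field k] [Group G] (Cc : GCoalgebra k G) : Prop :=
  (TensorProduct.comm k (Cc.C 1) (Cc.C 1)).toLinearMap ∘ₗ Cc.Δ 1 1 (one_mul 1).symm
    = Cc.Δ 1 1 (one_mul 1).symm
variable {k G : Type u} [Field k] [Group G]

/-- Convolution of functionals on `C_e`. -/
noncomputable def conv1 (Cc : GCoalgebra k G) (f g : Cc.C 1 →ₗ[k] k) :
    Cc.C 1 →ₗ[k] k :=
  LinearMap.mul' k k ∘ₗ TensorProduct.map f g ∘ₗ Cc.Δ 1 1 (one_mul 1).symm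

/-- `u` is a morphism of `G`-coalgebras `u̲ : C̲ → k⟨G⟩`: `u_e = ε` and
`u_α(c_{(1,α)}) u_β(c_{(2,β)}) = u_{αβ}(c)`. The set of such `u` is `Ω_{C̲}`. -/
def IsKGMorphism (Cc : GCoalgebra k G) (u : ∀ α : G, Cc.C α →ₗ[k] k) : Prop :=
  u 1 = Cc.ε ∧
  ∀ ⦃γ : G⦄ (α β : G) (h : γ = α * β),
    LinearMap.mul' k k ∘ₗ TensorProduct.map (u α) (u β) ∘ₗ Cc.Δ α β h = u γ

/-- The right `G`-action `c·α = λ_α(c) = u⁰_α(c_{(1,α)}) c_{(2,e)} u⁰_{α⁻¹}(c_{(3,α⁻¹)})`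
on `C_e` attached to `u⁰ ∈ Ω_{C̲}`. -/
noncomputable def actOf (Cc : GCoalgebra k G) (u₀ : ∀ α : G, Cc.C α →ₗ[k] k) (α : G) :
    Cc.C 1 →ₗ[k] Cc.C 1 :=
  cleftLam Cc u₀ (fun β => u₀ β⁻¹) α

/-- The 1-cochain `θ_α(c) = u_α(c_{(1,α)}) u⁰_{α⁻¹}(c_{(2,α⁻¹)})` attached to `u`. -/
noncomputable def thetaOf (Cc : GCoalgebra k G) (u₀ u : ∀ α : G, Cc.C α →ₗ[k] k)
    (α : G) : Cc.C 1 →ₗ[k] k :=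
  LinearMap.mul' k k ∘ₗ TensorProduct.map (u α) (u₀ α⁻¹) ∘ₗ
    Cc.Δ α α⁻¹ (mul_inv_cancel α).symm

/-- `θ ∈ Z¹(G, 𝔾_m(C_e*))`: each `θ_α` is convolution invertible and
`(α·θ_β) * θ_α = θ_{αβ}`. -/
noncomputable def IsOneCocycle (Cc : GCoalgebra k G)
    (u₀ : ∀ α : G, Cc.C α →ₗ[k] k) (θ : G → (Cc.C 1 →ₗ[k] k)) : Prop :=
  (∀ α : G, ∃ θ' : Cc.C 1 →ₗ[k] k,
    conv1 Cc (θ α) θ' = Cc.ε ∧ conv1 Cc θ' (θ α) = Cc.ε) ∧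
  ∀ α β : G, conv1 Cc (θ β ∘ₗ actOf Cc u₀ α) (θ α) = θ (α * β)

/-- The inverse map `Z¹ → Ω`: `u_α(c) = θ_α(c_{(1,e)}) u⁰_α(c_{(2,α)})`. -/
noncomputable def ofCocycle (Cc : GCoalgebra k G) (u₀ : ∀ α : G, Cc.C α →ₗ[k] k)
    (θ : G → (Cc.C 1 →ₗ[k] k)) (α : G) : Cc.C α →ₗ[k] k :=
  LinearMap.mul' k k ∘ₗ TensorProduct.map (θ α) (u₀ α) ∘ₗ Cc.Δ 1 α (one_mul α).symm

/-- The equivalence relation on `Ω_{C̲}`: `u ∼ u'` iff there is a convolution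
invertible `f ∈ C_e*` with `f(c_{(1,e)}) u_α(c_{(2,α)}) = u'_α(c_{(1,α)}) f(c_{(2,e)})`. -/
noncomputable def SimRel (Cc : GCoalgebra k G) (u u' : ∀ α : G, Cc.C α →ₗ[k] k) :
    Prop :=
  ∃ f g : Cc.C 1 →ₗ[k] k,
    conv1 Cc f g = Cc.ε ∧ conv1 Cc g f = Cc.ε ∧
    ∀ α : G,
      LinearMap.mul' k k ∘ₗ TensorProduct.map f (u α) ∘ₗ
          Cc.Δ 1 α (one_mul α).symm
        = LinearMap.mul' k k ∘ₗ TensorProduct.map (u' α) f ∘ₗ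
            Cc.Δ α 1 (mul_one α).symm

namespace GCoalgebra

/-- The convolution `(f * g)(c) = f(c_{(1,α)}) g(c_{(2,β)})` of functionals on the components
of a `G`-coalgebra. -/
noncomputable def convolution (Cc : GCoalgebra k G) {α β γ : G} (h : γ = α * β)
    (f : Cc.C α →ₗ[k] k) (g : Cc.C β →ₗ[k] k) : Cc.C γ →ₗ[k] k :=
  LinearMap.mul' k k ∘ₗ TensorProduct.map f g ∘ₗ Cc.Δ α β h

theorem convolution_assoc (Cc : GCoalgebra k G) {α β γ δ δ₁ δ₂ : G}
    (h₁ : δ = δ₁ * γ) (h₁' : δ₁ = α * β) (h₂ : δ = α * δ₂) (h₂' : δ₂ = β * γ)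
    (f : Cc.C α →ₗ[k] k) (g : Cc.C β →ₗ[k] k) (l : Cc.C γ →ₗ[k] k) :
    Cc.convolution h₁ (Cc.convolution h₁' f g) l =
      Cc.convolution h₂ f (Cc.convolution h₂' g l) := by
  have hl : LinearMap.mul' k k ∘ₗ
        TensorProduct.map (LinearMap.mul' k k ∘ₗ TensorProduct.map f g) l =
      (LinearMap.mul' k k ∘ₗ
        TensorProduct.map f (LinearMap.mul' k k ∘ₗ TensorProduct.map g l)) ∘ₗ
        (TensorProduct.assoc k (Cc.C α) (Cc.C β) (Cc.C γ)).toLinearMap := by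
    ext a b c
    simp [mul_assoc]
  calc Cc.convolution h₁ (Cc.convolution h₁' f g) l
      = (LinearMap.mul' k k ∘ₗ
          TensorProduct.map (LinearMap.mul' k k ∘ₗ TensorProduct.map f g) l) ∘ₗ
          TensorProduct.map (Cc.Δ α β h₁') LinearMap.id ∘ₗ Cc.Δ δ₁ γ h₁ := by
        rw [LinearMap.comp_assoc, ← LinearMap.comp_assoc _ _ (TensorProduct.map _ l),
          ← TensorProduct.map_comp]
        rfl
    _ = (LinearMap.mul' k k ∘ₗ
          TensorProduct.map f (LinearMap.mul' k k ∘ₗ TensorProduct.map g l)) ∘ₗ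
          TensorProduct.map LinearMap.id (Cc.Δ β γ h₂') ∘ₗ Cc.Δ α δ₂ h₂ := by
        rw [hl, LinearMap.comp_assoc, Cc.coassoc α β γ h₁ h₁' h₂ h₂']
    _ = Cc.convolution h₂ f (Cc.convolution h₂' g l) := by
        rw [LinearMap.comp_assoc, ← LinearMap.comp_assoc _ _ (TensorProduct.map f _),
          ← TensorProduct.map_comp]
        rfl

theorem convolution_counit (Cc : GCoalgebra k G) {α : G} (h : α = α * 1)
    (f : Cc.C α →ₗ[k] k) : Cc.convolution h f Cc.ε = f := by
  have hl : LinearMap.mul' k k ∘ₗ TensorProduct.map f Cc.ε =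
      f ∘ₗ (TensorProduct.rid k (Cc.C α)).toLinearMap ∘ₗ
        TensorProduct.map LinearMap.id Cc.ε := by
    ext a b
    simp [mul_comm]
  rw [convolution, ← LinearMap.comp_assoc, hl, LinearMap.comp_assoc, LinearMap.comp_assoc,
    Cc.counit_right, LinearMap.comp_id]

theorem counit_convolution (Cc : GCoalgebra k G) {α : G} (h : α = 1 * α)
    (f : Cc.C α →ₗ[k] k) : Cc.convolution h Cc.ε f = f := by
  have hl : LinearMap.mul' k k ∘ₗ TensorProduct.map Cc.ε f =
      f ∘ₗ (TensorProduct.lid k (Cc.C α)).toLinearMap ∘ₗ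
        TensorProduct.map Cc.ε LinearMap.id := by
    ext a b
    simp
  rw [convolution, ← LinearMap.comp_assoc, hl, LinearMap.comp_assoc, LinearMap.comp_assoc,
    Cc.counit_left, LinearMap.comp_id]

/-- The homogeneous functionals on a `G`-coalgebra. -/
structure HomogeneousDual (Cc : GCoalgebra k G) where
  degree : G
  toFun : Cc.C degree →ₗ[k] k

namespace HomogeneousDual

variable {Cc : GCoalgebra k G}

noncomputable instance : Mul (HomogeneousDual Cc) :=
  ⟨fun x y => ⟨x.degree * y.degree, Cc.convolution rfl x.toFun y.toFun⟩⟩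

instance : One (HomogeneousDual Cc) := ⟨⟨1, Cc.ε⟩⟩

theorem mk_convolution {α β γ : G} (h : γ = α * β) (f : Cc.C α →ₗ[k] k)
    (g : Cc.C β →ₗ[k] k) :
    (⟨γ, Cc.convolution h f g⟩ : HomogeneousDual Cc) = ⟨α, f⟩ * ⟨β, g⟩ := by
  subst h
  rfl

theorem mk_counit : (⟨1, Cc.ε⟩ : HomogeneousDual Cc) = 1 := rfl

theorem mk_inj {α : G} {f g : Cc.C α →ₗ[k] k} :
    (⟨α, f⟩ : HomogeneousDual Cc) = ⟨α, g⟩ ↔ f = g := by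
  simp

noncomputable instance : Monoid (HomogeneousDual Cc) where
  mul_assoc x y z := by
    obtain ⟨α, f⟩ := x
    obtain ⟨β, g⟩ := y
    obtain ⟨γ, l⟩ := z
    rw [← mk_convolution rfl f g, ← mk_convolution rfl g l,
      ← mk_convolution (mul_assoc α β γ), ← mk_convolution rfl,
      Cc.convolution_assoc rfl rfl (mul_assoc α β γ) rfl]
  one_mul x := by
    rw [← mk_counit, ← mk_convolution (one_mul x.degree).symm, Cc.counit_convolution]
  mul_one x := by
    rw [← mk_counit, ← mk_convolution (mul_one x.degree).symm, Cc.convolution_counit]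

theorem mk_conv1 (f g : Cc.C 1 →ₗ[k] k) :
    (⟨1, conv1 Cc f g⟩ : HomogeneousDual Cc) = ⟨1, f⟩ * ⟨1, g⟩ :=
  mk_convolution (one_mul 1).symm f g

theorem mk_thetaOf (u₀ u : ∀ α : G, Cc.C α →ₗ[k] k) (α : G) :
    (⟨1, thetaOf Cc u₀ u α⟩ : HomogeneousDual Cc) = ⟨α, u α⟩ * ⟨α⁻¹, u₀ α⁻¹⟩ :=
  mk_convolution (mul_inv_cancel α).symm (u α) (u₀ α⁻¹)

theorem mk_ofCocycle (u₀ : ∀ α : G, Cc.C α →ₗ[k] k) (θ : G → (Cc.C 1 →ₗ[k] k)) (α : G) :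
    (⟨α, ofCocycle Cc u₀ θ α⟩ : HomogeneousDual Cc) = ⟨1, θ α⟩ * ⟨α, u₀ α⟩ :=
  mk_convolution (one_mul α).symm (θ α) (u₀ α)

theorem mk_comp_actOf (u₀ : ∀ α : G, Cc.C α →ₗ[k] k) (f : Cc.C 1 →ₗ[k] k) (α : G) :
    (⟨1, f ∘ₗ actOf Cc u₀ α⟩ : HomogeneousDual Cc) =
      ⟨α, u₀ α⟩ * (⟨1, f⟩ * ⟨α⁻¹, u₀ α⁻¹⟩) := by
  rw [← mk_convolution (one_mul α⁻¹).symm, ← mk_convolution (mul_inv_cancel α).symm, mk_inj]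
  have hr : LinearMap.mul' k k ∘ₗ TensorProduct.map f (u₀ α⁻¹) =
      f ∘ₗ (TensorProduct.rid k (Cc.C 1)).toLinearMap ∘ₗ
        TensorProduct.map LinearMap.id (u₀ α⁻¹) := by
    ext a b
    simp [mul_comm]
  have hl : ∀ w : Cc.C α⁻¹ →ₗ[k] Cc.C 1, LinearMap.mul' k k ∘ₗ
      TensorProduct.map (u₀ α) (f ∘ₗ w) =
      f ∘ₗ (TensorProduct.lid k (Cc.C 1)).toLinearMap ∘ₗ TensorProduct.map (u₀ α) w := by
    intro w
    ext a b
    simp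
  rw [convolution, convolution, ← LinearMap.comp_assoc (Cc.Δ 1 α⁻¹ _), hr,
    LinearMap.comp_assoc, ← LinearMap.comp_assoc (Cc.Δ α α⁻¹ _), hl, actOf, cleftLam,
    ← LinearMap.comp_assoc (Cc.Δ α α⁻¹ _) (LinearMap.lTensor _ _),
    LinearMap.map_comp_lTensor]
  rfl

theorem commute_of_cocommutative (hc : CeCocommutative Cc) (f g : Cc.C 1 →ₗ[k] k) :
    Commute (⟨1, f⟩ : HomogeneousDual Cc) ⟨1, g⟩ := by
  have hl : LinearMap.mul' k k ∘ₗ TensorProduct.map f g ∘ₗ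
      (TensorProduct.comm k (Cc.C 1) (Cc.C 1)).toLinearMap =
      LinearMap.mul' k k ∘ₗ TensorProduct.map g f := by
    ext a b
    simp [mul_comm]
  rw [Commute, SemiconjBy, ← mk_conv1, ← mk_conv1, mk_inj, conv1, ← hc,
    ← LinearMap.comp_assoc _ _ (TensorProduct.map f g),
    ← LinearMap.comp_assoc _ _ (LinearMap.mul' k k), hl, conv1, LinearMap.comp_assoc]

end HomogeneousDual

end GCoalgebra

open GCoalgebra HomogeneousDual

theorem isKGMorphism_iff {Cc : GCoalgebra k G} {u : ∀ α : G, Cc.C α →ₗ[k] k} :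
    IsKGMorphism Cc u ↔ (⟨1, u 1⟩ : HomogeneousDual Cc) = 1 ∧
      ∀ α β : G, (⟨α, u α⟩ * ⟨β, u β⟩ : HomogeneousDual Cc) = ⟨α * β, u (α * β)⟩ := by
  rw [← mk_counit, mk_inj]
  refine and_congr_right fun _ => ⟨fun h α β => ?_, fun h γ α β e => ?_⟩
  · rw [← mk_convolution rfl, mk_inj]
    exact h α β rfl
  · subst e
    have := h α β
    rwa [← mk_convolution rfl, mk_inj] at this

theorem isOneCocycle_iff {Cc : GCoalgebra k G} {u₀ : ∀ α : G, Cc.C α →ₗ[k] k}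
    {θ : G → (Cc.C 1 →ₗ[k] k)} :
    IsOneCocycle Cc u₀ θ ↔
      (∀ α : G, ∃ θ' : Cc.C 1 →ₗ[k] k,
        (⟨1, θ α⟩ * ⟨1, θ'⟩ : HomogeneousDual Cc) = 1 ∧
        (⟨1, θ'⟩ * ⟨1, θ α⟩ : HomogeneousDual Cc) = 1) ∧
      ∀ α β : G, (⟨α, u₀ α⟩ * (⟨1, θ β⟩ * ⟨α⁻¹, u₀ α⁻¹⟩) * ⟨1, θ α⟩ : HomogeneousDual Cc) =
        ⟨1, θ (α * β)⟩ := by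
  simp only [IsOneCocycle, ← mk_inj (Cc := Cc), mk_conv1, mk_counit, mk_comp_actOf]

theorem IsKGMorphism.mul_inv {Cc : GCoalgebra k G} {u : ∀ α : G, Cc.C α →ₗ[k] k}
    (hu : IsKGMorphism Cc u) (α : G) :
    (⟨α, u α⟩ * ⟨α⁻¹, u α⁻¹⟩ : HomogeneousDual Cc) = 1 := by
  rw [(isKGMorphism_iff.1 hu).2, mul_inv_cancel, (isKGMorphism_iff.1 hu).1]

theorem IsKGMorphism.inv_mul {Cc : GCoalgebra k G} {u : ∀ α : G, Cc.C α →ₗ[k] k}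
    (hu : IsKGMorphism Cc u) (α : G) :
    (⟨α⁻¹, u α⁻¹⟩ * ⟨α, u α⟩ : HomogeneousDual Cc) = 1 := by
  rw [(isKGMorphism_iff.1 hu).2, inv_mul_cancel, (isKGMorphism_iff.1 hu).1]

theorem isOneCocycle_thetaOf {Cc : GCoalgebra k G} (hc : CeCocommutative Cc)
    {u₀ u : ∀ α : G, Cc.C α →ₗ[k] k} (hu₀ : IsKGMorphism Cc u₀) (hu : IsKGMorphism Cc u) :
    IsOneCocycle Cc u₀ (thetaOf Cc u₀ u) := by
  refine isOneCocycle_iff.2 ⟨fun α => ⟨thetaOf Cc u u₀ α, ?_, ?_⟩, fun α β => ?_⟩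
  · rw [mk_thetaOf, mk_thetaOf, mul_assoc, ← mul_assoc _ _ (⟨α⁻¹, u α⁻¹⟩ : HomogeneousDual Cc),
      hu₀.inv_mul, one_mul, hu.mul_inv]
  · rw [mk_thetaOf, mk_thetaOf, mul_assoc, ← mul_assoc _ _ (⟨α⁻¹, u₀ α⁻¹⟩ : HomogeneousDual Cc),
      hu.inv_mul, one_mul, hu₀.mul_inv]
  · rw [← mk_comp_actOf, (commute_of_cocommutative hc _ _).eq, mk_comp_actOf, mk_thetaOf,
      mul_assoc, ← mul_assoc _ (⟨α, u₀ α⟩ : HomogeneousDual Cc), hu₀.inv_mul, one_mul,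
      mk_thetaOf, mul_assoc, (isKGMorphism_iff.1 hu₀).2, ← mul_inv_rev, ← mul_assoc,
      (isKGMorphism_iff.1 hu).2, mk_thetaOf]

theorem ofCocycle_thetaOf {Cc : GCoalgebra k G} {u₀ : ∀ α : G, Cc.C α →ₗ[k] k}
    (hu₀ : IsKGMorphism Cc u₀) (u : ∀ α : G, Cc.C α →ₗ[k] k) :
    ofCocycle Cc u₀ (thetaOf Cc u₀ u) = u := by
  funext α
  rw [← mk_inj, mk_ofCocycle, mk_thetaOf, mul_assoc, hu₀.inv_mul, mul_one]

theorem thetaOf_ofCocycle {Cc : GCoalgebra k G} {u₀ : ∀ α : G, Cc.C α →ₗ[k] k}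
    (hu₀ : IsKGMorphism Cc u₀) (θ : G → (Cc.C 1 →ₗ[k] k)) :
    thetaOf Cc u₀ (ofCocycle Cc u₀ θ) = θ := by
  funext α
  rw [← mk_inj, mk_thetaOf, mk_ofCocycle, mul_assoc, hu₀.mul_inv, mul_one]

theorem isKGMorphism_ofCocycle {Cc : GCoalgebra k G} (hc : CeCocommutative Cc)
    {u₀ : ∀ α : G, Cc.C α →ₗ[k] k} (hu₀ : IsKGMorphism Cc u₀)
    {θ : G → (Cc.C 1 →ₗ[k] k)} (hθ : IsOneCocycle Cc u₀ θ) :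
    IsKGMorphism Cc (ofCocycle Cc u₀ θ) := by
  obtain ⟨hinv, hmul⟩ := isOneCocycle_iff.1 hθ
  obtain ⟨h1, h0⟩ := isKGMorphism_iff.1 hu₀
  refine isKGMorphism_iff.2 ⟨?_, fun α β => ?_⟩
  · obtain ⟨θ', h, -⟩ := hinv 1
    have hidem : (⟨1, θ 1⟩ * ⟨1, θ 1⟩ : HomogeneousDual Cc) = ⟨1, θ 1⟩ := by
      have hi := hu₀.mul_inv 1
      rw [h1, one_mul] at hi
      have hm := hmul 1 1
      rwa [h1, hi, one_mul, mul_one, mul_one] at hm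
    rw [mk_ofCocycle, h1, mul_one, ← h]
    nth_rw 2 [← hidem]
    rw [mul_assoc, h, mul_one]
  · rw [mk_ofCocycle, mk_ofCocycle, mk_ofCocycle, ← hmul, ← h0, ← mk_comp_actOf,
      (commute_of_cocommutative hc _ _).eq, mk_comp_actOf]
    simp only [mul_assoc]
    rw [← mul_assoc _ (⟨α, u₀ α⟩ : HomogeneousDual Cc) (⟨β, u₀ β⟩ : HomogeneousDual Cc),
      hu₀.inv_mul, one_mul]

theorem semiconj_iff_thetaOf_eq {Cc : GCoalgebra k G} (hc : CeCocommutative Cc)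
    {u₀ : ∀ α : G, Cc.C α →ₗ[k] k} (hu₀ : IsKGMorphism Cc u₀)
    (u u' : ∀ α : G, Cc.C α →ₗ[k] k) {f g : Cc.C 1 →ₗ[k] k}
    (hfg : conv1 Cc f g = Cc.ε) (α : G) :
    Cc.convolution (one_mul α).symm f (u α) = Cc.convolution (mul_one α).symm (u' α) f ↔
      thetaOf Cc u₀ u α =
        conv1 Cc (thetaOf Cc u₀ u' α) (conv1 Cc (f ∘ₗ actOf Cc u₀ α) g) := by
  have hfg' : (⟨1, f⟩ * ⟨1, g⟩ : HomogeneousDual Cc) = 1 := by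
    rw [← mk_conv1, hfg, mk_counit]
  have hgf : (⟨1, g⟩ * ⟨1, f⟩ : HomogeneousDual Cc) = 1 := by
    rw [← hfg', (commute_of_cocommutative hc g f).eq]
  have hR : (⟨1, conv1 Cc (thetaOf Cc u₀ u' α) (conv1 Cc (f ∘ₗ actOf Cc u₀ α) g)⟩ :
      HomogeneousDual Cc) = ⟨α, u' α⟩ * ⟨1, f⟩ * ⟨α⁻¹, u₀ α⁻¹⟩ * ⟨1, g⟩ := by
    rw [mk_conv1, mk_conv1, mk_comp_actOf, mk_thetaOf]
    simp only [mul_assoc]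
    rw [← mul_assoc _ (⟨α, u₀ α⟩ : HomogeneousDual Cc), hu₀.inv_mul, one_mul]
  rw [← mk_inj, ← mk_inj, hR, mk_convolution, mk_convolution]
  constructor
  · intro h
    rw [← h, mul_assoc _ _ (⟨α⁻¹, u₀ α⁻¹⟩ : HomogeneousDual Cc), ← mk_thetaOf,
      (commute_of_cocommutative hc f _).eq, mul_assoc, hfg', mul_one]
  · intro h
    have hcomm := (commute_of_cocommutative hc f (thetaOf Cc u₀ u α)).eq
    rw [h, mul_assoc _ _ (⟨1, f⟩ : HomogeneousDual Cc), hgf, mul_one, ← h, mk_thetaOf] at hcomm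
    have := congrArg (· * (⟨α, u₀ α⟩ : HomogeneousDual Cc)) hcomm
    simpa only [mul_assoc, hu₀.inv_mul, mul_one] using this

/-- **Propositions 4.4 and 4.5.** Suppose `Ω_{C̲} ≠ ∅` and fix `u⁰ ∈ Ω_{C̲}`, `C_e`
cocommutative. Then `u ↦ θ` with `θ_α(c) = u_α(c_{(1,α)}) u⁰_{α⁻¹}(c_{(2,α⁻¹)})` is a
bijection `Ω_{C̲} → Z¹(G, 𝔾_m(C_e*))` with inverse `θ ↦ (c ↦ θ_α(c_{(1,e)}) u⁰_α(c_{(2,α)}))`,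
and it induces a bijection `Ω_{C̲}/∼ → H¹(G, 𝔾_m(C_e*))`. -/
theorem omega_bijection_with_cocycles (Cc : GCoalgebra k G)
    (hcocomm : CeCocommutative Cc)
    (u₀ : ∀ α : G, Cc.C α →ₗ[k] k) (hu₀ : IsKGMorphism Cc u₀) :
    (∀ u : ∀ α : G, Cc.C α →ₗ[k] k, IsKGMorphism Cc u →
      IsOneCocycle Cc u₀ (thetaOf Cc u₀ u)) ∧
    (∀ u : ∀ α : G, Cc.C α →ₗ[k] k, IsKGMorphism Cc u →
      ofCocycle Cc u₀ (thetaOf Cc u₀ u) = u) ∧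
    (∀ θ : G → (Cc.C 1 →ₗ[k] k), IsOneCocycle Cc u₀ θ →
      IsKGMorphism Cc (ofCocycle Cc u₀ θ) ∧ thetaOf Cc u₀ (ofCocycle Cc u₀ θ) = θ) ∧
    (∀ u u' : ∀ α : G, Cc.C α →ₗ[k] k, IsKGMorphism Cc u → IsKGMorphism Cc u' →
      (SimRel Cc u u' ↔
        ∃ f g : Cc.C 1 →ₗ[k] k,
          conv1 Cc f g = Cc.ε ∧ conv1 Cc g f = Cc.ε ∧
          ∀ α : G, thetaOf Cc u₀ u α
            = conv1 Cc (thetaOf Cc u₀ u' α)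
                (conv1 Cc (f ∘ₗ actOf Cc u₀ α) g))) := by
  refine ⟨fun u hu => isOneCocycle_thetaOf hcocomm hu₀ hu,
    fun u _ => ofCocycle_thetaOf hu₀ u,
    fun θ hθ => ⟨isKGMorphism_ofCocycle hcocomm hu₀ hθ, thetaOf_ofCocycle hu₀ θ⟩,
    fun u u' _ _ => ?_⟩
  refine exists_congr fun f => exists_congr fun g => and_congr_right fun hfg =>
    and_congr_right fun _ => forall_congr' fun α => ?_
  exact semiconj_iff_thetaOf_eq hcocomm hu₀ u u' hfg α
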